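/- Let Λ = {a_1,…,a_ℓ} be a collection of sequences of positive integers with ℓ ≥ 2 and (X,T) a topological dynamical system. If a closed subset E of X is Δ-weakly mixing along Λ and contains at least two points, then E is a perfect set (E is closed and has no isolated points). -/

import Mathlib

open MeasureTheory Filter Topology Set

/-- `E` is Δ-transitive along the collection `a` of sequences: there is a residual subset
`A` of `E` (in the subspace topology) such that for every `x ∈ A`,
`E^ℓ ⊆ closure {(T^{a₁(n)}x, …, T^{a_ℓ(n)}x) : n ∈ ℕ}`. -/
def DeltaTransAlong {X : Type*} [TopologicalSpace X] {ℓ : ℕ} (T : X → X)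
    (a : Fin ℓ → ℕ → ℕ) (E : Set X) : Prop :=
  ∃ A ∈ residual ↥E, ∀ x ∈ A,
    {y : Fin ℓ → X | ∀ i, y i ∈ E} ⊆
      closure {y : Fin ℓ → X | ∃ n : ℕ, 1 ≤ n ∧ y = fun i => T^[a i n] (x : X)}

/-- `E` is Δ-weakly mixing along the collection `a` of sequences: for every `m ∈ ℕ`, the set
`E^m` is a Δ-transitive subset of the product system `(X^m, T × ⋯ × T)` along `a`. -/
def DeltaWeakMixAlong {X : Type*} [TopologicalSpace X] {ℓ : ℕ} (T : X → X)
    (a : Fin ℓ → ℕ → ℕ) (E : Set X) : Prop :=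
  ∀ m : ℕ, 1 ≤ m →
    DeltaTransAlong (fun y : Fin m → X => T ∘ y) a {y : Fin m → X | ∀ j, y j ∈ E}

/-- Every iterate of the diagonal product map acts coordinatewise. -/
theorem iterate_comp_left_apply {X ι : Type*} (T : X → X) (n : ℕ) (y : ι → X) (j : ι) :
    (fun y : ι → X => T ∘ y)^[n] y j = T^[n] (y j) := by
  induction n generalizing y with
  | zero => rfl
  | succ n ih => rw [Function.iterate_succ_apply, ih, Function.iterate_succ_apply]; rfl

/-- In a Baire space, a residual set contains every isolated point. -/
theorem mem_of_mem_residual_of_isOpen_singleton {Y : Type*} [TopologicalSpace Y] [BaireSpace Y]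
    {A : Set Y} (hA : A ∈ residual Y) {p : Y} (hp : IsOpen ({p} : Set Y)) : p ∈ A := by
  obtain ⟨q, hq, hqA⟩ := (dense_of_mem_residual hA).inter_open_nonempty _ hp ⟨p, rfl⟩
  exact mem_singleton_iff.1 hq ▸ hqA

/-- Proposition: if `ℓ ≥ 2` and a closed subset `E` of a compact metric dynamical system
`(X,T)` is Δ-weakly mixing along `Λ = {a₁,…,a_ℓ}` and has at least two points, then `E` is a
perfect set. -/
theorem deltaWeakMixAlong_perfect
    {ℓ : ℕ} (hℓ : 2 ≤ ℓ) (a : Fin ℓ → ℕ → ℕ) (hpos : ∀ i n, 0 < a i n)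
    {X : Type*} [MetricSpace X] [CompactSpace X] (T : X ≃ₜ X)
    (E : Set X) (hE : IsClosed E) (hnt : E.Nontrivial)
    (hwm : DeltaWeakMixAlong (⇑T) a E) :
    Perfect E := by
  refine ⟨hE, fun x hx => ?_⟩
  by_contra hacc
  obtain ⟨U, hU, hUE⟩ : ∃ U ∈ 𝓝 x, ∀ y ∈ U ∩ E, y = x := by
    rw [accPt_iff_nhds] at hacc
    push Not at hacc
    exact hacc
  obtain ⟨V, hVU, hVo, hxV⟩ := mem_nhds_iff.1 hU
  obtain ⟨y, hy, hyx⟩ := hnt.exists_ne x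
  obtain ⟨A, hA, hAd⟩ := hwm 2 one_le_two
  have hS : IsClosed {y : Fin 2 → X | ∀ j, y j ∈ E} := by
    simp only [ofPred_forall]
    exact isClosed_iInter fun j => hE.preimage (continuous_apply j)
  have : CompactSpace ↥{y : Fin 2 → X | ∀ j, y j ∈ E} :=
    isCompact_iff_compactSpace.1 hS.isCompact
  have hpA := mem_of_mem_residual_of_isOpen_singleton hA (p := ⟨fun _ => x, fun _ => hx⟩) (by
    have ho : IsOpen {q : ↥{y : Fin 2 → X | ∀ j, y j ∈ E} | ∀ j, q.1 j ∈ V} := by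
      simp only [ofPred_forall]
      exact isOpen_iInter_of_finite fun j =>
        hVo.preimage ((continuous_apply j).comp continuous_subtype_val)
    convert ho using 1
    ext q
    refine ⟨fun hq => ?_, fun hq => Subtype.ext (funext fun j => hUE _ ⟨hVU (hq j), q.2 j⟩)⟩
    rw [mem_singleton_iff.1 hq]
    exact fun _ => hxV)
  let i₀ : Fin ℓ := ⟨0, by omega⟩
  have hdiag : closure {z : Fin ℓ → Fin 2 → X | ∃ n : ℕ, 1 ≤ n ∧
      z = fun i => (fun y : Fin 2 → X => ⇑T ∘ y)^[a i n] (fun _ => x)} ⊆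
      {z | z i₀ 0 = z i₀ 1} := by
    refine closure_minimal ?_ (isClosed_eq (by fun_prop) (by fun_prop))
    rintro z ⟨n, -, rfl⟩
    simp only [mem_ofPred_eq, iterate_comp_left_apply]
  have hmem : (fun _ => ![x, y] : Fin ℓ → Fin 2 → X) ∈
      {z : Fin ℓ → Fin 2 → X | ∀ i, z i ∈ {y : Fin 2 → X | ∀ j, y j ∈ E}} := by
    intro i j
    fin_cases j
    · exact hx
    · exact hy
  have hxy : x = y := hdiag (hAd _ hpA hmem)
  exact hyx hxy.symm
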